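/- Let {(μ_k, u_k)}_{k≥0} be the sequence of discrete first eigenpairs generated by the adaptive algorithm (so ‖u_k‖_{L^p(Ω)} = 1 and J(u_k) = μ_k on each nested mesh level). Then for every element T ∈ T_k the local error indicator satisfies η_k^q(μ_k, u_k; T) ≤ C ( h_T^q ‖u_k‖_{L^p(T)}^p + ‖∇u_k‖_{L^p(D_T)}^p ), and the global estimator satisfies η_k(μ_k, u_k) ≤ C̃, where C and C̃ depend on μ_0 and the shape regularity of the initial mesh but not on k; here D_T is the union of elements sharing part of their boundary with T. -/

import Mathlib

open MeasureTheory Filter Topology Metric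
open scoped RealInnerProductSpace ENNReal NNReal Classical

noncomputable section

namespace PLaplacianAFEM

/-- Euclidean space ℝ^d. -/
abbrev E (d : ℕ) := EuclideanSpace ℝ (Fin d)

/-- ∫_Ω |u|^p dx. -/
def lpPow (d : ℕ) (Ω : Set (E d)) (p : ℝ) (u : E d → ℝ) : ℝ :=
  ∫ x in Ω, |u x| ^ p

/-- ∫_Ω |∇u|^p dx. -/
def gradPow (d : ℕ) (Ω : Set (E d)) (p : ℝ) (u : E d → ℝ) : ℝ :=
  ∫ x in Ω, ‖gradient u x‖ ^ p

/-- Rayleigh quotient J(u) = (∫_Ω |∇u|^p)/(∫_Ω |u|^p). -/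
def rayleigh (d : ℕ) (Ω : Set (E d)) (p : ℝ) (u : E d → ℝ) : ℝ :=
  gradPow d Ω p u / lpPow d Ω p u

/-- The W^{1,p}(Ω)-norm. -/
def w1pNorm (d : ℕ) (Ω : Set (E d)) (p : ℝ) (u : E d → ℝ) : ℝ :=
  (lpPow d Ω p u + gradPow d Ω p u) ^ (1 / p)

/-- W^{1,p}(Ω)-distance. -/
def w1pDist (d : ℕ) (Ω : Set (E d)) (p : ℝ) (u v : E d → ℝ) : ℝ :=
  w1pNorm d Ω p (u - v)

/-- A smooth test function compactly supported in Ω. -/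
def IsTestFun (d : ℕ) (Ω : Set (E d)) (v : E d → ℝ) : Prop :=
  ContDiff ℝ (⊤ : ℕ∞) v ∧ HasCompactSupport v ∧ tsupport v ⊆ Ω

/-- W_0^{1,p}(Ω), the closure of C_c^∞(Ω) in the W^{1,p}(Ω)-norm. -/
def sobolevW0 (d : ℕ) (Ω : Set (E d)) (p : ℝ) : Set (E d → ℝ) :=
  {u | ∀ ε > 0, ∃ φ, IsTestFun d Ω φ ∧ w1pDist d Ω p u φ < ε}

/-- A (closed) d-simplex in ℝ^d. -/
def IsSimplex (d : ℕ) (K : Set (E d)) : Prop :=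
  ∃ v : Fin (d + 1) → E d, AffineIndependent ℝ v ∧ K = convexHull ℝ (Set.range v)

/-- A conforming simplicial triangulation of the closure of Ω. -/
def IsTriangulation (d : ℕ) (Ω : Set (E d)) (T : Finset (Set (E d))) : Prop :=
  (∀ K ∈ T, IsSimplex d K) ∧
  (⋃ K ∈ T, K) = closure Ω ∧
  (∀ K ∈ T, ∀ K' ∈ T, K ≠ K' → interior K ∩ interior K' = ∅)

/-- The conforming P1 finite element space on the mesh T : continuous functions,
vanishing outside Ω (in particular on ∂Ω), affine on each element. -/
def femSpace (d : ℕ) (Ω : Set (E d)) (T : Finset (Set (E d))) : Set (E d → ℝ) :=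
  {u | ContinuousOn u (closure Ω) ∧ (∀ x ∉ Ω, u x = 0) ∧
    ∀ K ∈ T, ∃ (L : E d →L[ℝ] ℝ) (c : ℝ), ∀ x ∈ K, u x = L x + c}

/-- Element size h_T := |T|^{1/d}. -/
def meshSize (d : ℕ) (K : Set (E d)) : ℝ := (volume K).toReal ^ ((1 : ℝ) / d)

/-- Face size h_F := |F|^{1/(d-1)} (with |F| the (d-1)-dimensional Hausdorff measure). -/
def faceSize (d : ℕ) (F : Set (E d)) : ℝ :=
  (μH[(d : ℝ) - 1] F).toReal ^ ((1 : ℝ) / ((d : ℝ) - 1))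

/-- The patch D_K of all elements touching K. -/
def patch (d : ℕ) (T : Finset (Set (E d))) (K : Set (E d)) : Set (E d) :=
  ⋃ K' ∈ T, ⋃ (_ : (K ∩ K').Nonempty), K'

/-- The nonlinear flux of a (constant) gradient g : |g|^{p-2} g. -/
def flux (d : ℕ) (p : ℝ) (g : E d) : E d := ‖g‖ ^ (p - 2) • g

/-- A (d-1)-dimensional simplex (possible face of elements). -/
def IsFaceSimplex (d : ℕ) (F : Set (E d)) : Prop :=
  ∃ w : Fin d → E d, AffineIndependent ℝ w ∧ F = convexHull ℝ (Set.range w)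

/-- An interior face: a (d-1)-simplex not contained in ∂Ω. -/
def IsInteriorFace (d : ℕ) (Ω : Set (E d)) (F : Set (E d)) : Prop :=
  IsFaceSimplex d F ∧ ¬ F ⊆ frontier Ω

/-- The local error indicator η_k^q(μ, u; K) (with q = p/(p-1)); `g K'` is the
(constant) gradient of the piecewise linear u on the element K', so that the jump of
the flux across the face K ∩ K' is flux(g K) - flux(g K') (it is normal to the face
for continuous piecewise linear u). -/
def etaQLoc (d : ℕ) (Ω : Set (E d)) (p : ℝ) (T : Finset (Set (E d)))
    (g : Set (E d) → E d) (μ : ℝ) (u : E d → ℝ) (K : Set (E d)) : ℝ :=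
  meshSize d K ^ (p / (p - 1)) *
      (∫ x in K, |μ * |u x| ^ (p - 2) * u x| ^ (p / (p - 1)))
  + ∑ K' ∈ T, if K' ≠ K ∧ IsInteriorFace d Ω (K ∩ K') then
      faceSize d (K ∩ K') *
        ∫ x in K ∩ K', ‖flux d p (g K) - flux d p (g K')‖ ^ (p / (p - 1)) ∂ μH[(d : ℝ) - 1]
    else 0

/-- The error estimator η_k(μ,u;M) := (Σ_{K ∈ M} η_k^q(μ,u;K))^{1/q}. -/
def etaOn (d : ℕ) (Ω : Set (E d)) (p : ℝ) (T : Finset (Set (E d)))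
    (g : Set (E d) → E d) (μ : ℝ) (u : E d → ℝ) (M : Finset (Set (E d))) : ℝ :=
  (∑ K ∈ M, etaQLoc d Ω p T g μ u K) ^ ((p - 1) / p)

/-- The residual ⟨R(μ,u), v⟩. -/
def residual (d : ℕ) (Ω : Set (E d)) (p : ℝ) (μ : ℝ) (u v : E d → ℝ) : ℝ :=
  (∫ x in Ω, ‖gradient u x‖ ^ (p - 2) * ⟪gradient u x, gradient v x⟫)
    - μ * ∫ x in Ω, |u x| ^ (p - 2) * u x * v x

/-- The first Dirichlet eigenvalue λ₁ = inf_{v ∈ W_0^{1,p}(Ω)\{0}} J(v). -/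
def lambda1 (d : ℕ) (Ω : Set (E d)) (p : ℝ) : ℝ :=
  sInf (rayleigh d Ω p '' {v | v ∈ sobolevW0 d Ω p ∧ lpPow d Ω p v ≠ 0})

/-- The set E of all L^p-normalized eigenfunctions of the Dirichlet p-Laplacian. -/
def ESet (d : ℕ) (Ω : Set (E d)) (p : ℝ) : Set (E d → ℝ) :=
  {u | u ∈ sobolevW0 d Ω p ∧ lpPow d Ω p u = 1 ∧ ∃ lam : ℝ,
    ∀ v ∈ sobolevW0 d Ω p,
      (∫ x in Ω, ‖gradient u x‖ ^ (p - 2) * ⟪gradient u x, gradient v x⟫)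
        = lam * ∫ x in Ω, |u x| ^ (p - 2) * u x * v x}

/-- The set E_{λ₁} of L^p-normalized first eigenfunctions. -/
def firstEigenSet (d : ℕ) (Ω : Set (E d)) (p : ℝ) : Set (E d → ℝ) :=
  {u | u ∈ sobolevW0 d Ω p ∧ lpPow d Ω p u = 1 ∧
    ∀ v ∈ sobolevW0 d Ω p,
      (∫ x in Ω, ‖gradient u x‖ ^ (p - 2) * ⟪gradient u x, gradient v x⟫)
        = lambda1 d Ω p * ∫ x in Ω, |u x| ^ (p - 2) * u x * v x}

/-- W^{2,∞}(Ω)-norm of a smooth function. -/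
def w2inftyNorm (d : ℕ) (Ω : Set (E d)) (v : E d → ℝ) : ℝ :=
  sSup ((fun x => |v x| + ‖fderiv ℝ v x‖ + ‖fderiv ℝ (fderiv ℝ v) x‖) '' Ω)

/-- The data produced by the adaptive finite element algorithm (AFEM):
nested, uniformly γ-shape-regular conforming triangulations T k obtained by marking
(each marked set containing an element of maximal local error indicator) and bisection,
discrete first eigenpairs (μ k, u k) with nonnegative, L^p-normalized minimizers of the
Rayleigh quotient over the P1 space, and g k K the constant gradient of u k on K. -/
structure AFEM (d : ℕ) (Ω : Set (E d)) (p : ℝ) (γ : ℝ) where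
  T : ℕ → Finset (Set (E d))
  g : ℕ → Set (E d) → E d
  u : ℕ → E d → ℝ
  μ : ℕ → ℝ
  M : ℕ → Finset (Set (E d))
  tri : ∀ k, IsTriangulation d Ω (T k)
  shape : ∀ k, ∀ K ∈ T k, ∃ x r, 0 < r ∧ ball x r ⊆ K ∧ diam K ≤ γ * r
  nested : ∀ k, femSpace d Ω (T k) ⊆ femSpace d Ω (T (k + 1))
  mem : ∀ k, u k ∈ femSpace d Ω (T k)
  sob : ∀ k, u k ∈ sobolevW0 d Ω p
  gradComp : ∀ k, ∀ K ∈ T k, ∃ c : ℝ, ∀ x ∈ K, u k x = ⟪g k K, x⟫ + c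
  normed : ∀ k, lpPow d Ω p (u k) = 1
  nonneg : ∀ k, ∀ x, 0 ≤ u k x
  minim : ∀ k, ∀ v ∈ femSpace d Ω (T k), v ≠ 0 →
    rayleigh d Ω p (u k) ≤ rayleigh d Ω p v
  eig : ∀ k, μ k = rayleigh d Ω p (u k)
  marked : ∀ k, M k ⊆ T k
  markedNe : ∀ k, (M k).Nonempty
  markMax : ∀ k, ∃ K ∈ M k, ∀ K' ∈ T k,
    etaQLoc d Ω p (T k) (g k) (μ k) (u k) K' ≤ etaQLoc d Ω p (T k) (g k) (μ k) (u k) K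
  refined : ∀ k, ∀ K ∈ M k, K ∉ T (k + 1)

variable {d : ℕ} {Ω : Set (E d)} {p γ : ℝ}

/-- The limit space V_∞ := closure of ∪_k V_k in the W^{1,p}-norm. -/
def Vinf (A : AFEM d Ω p γ) : Set (E d → ℝ) :=
  {v | ∀ ε > 0, ∃ k, ∃ w ∈ femSpace d Ω (A.T k), w1pDist d Ω p v w < ε}

/-- T_k^+ : the elements of T k never refined afterwards. -/
def Tplus (A : AFEM d Ω p γ) (k : ℕ) : Finset (Set (E d)) :=
  (A.T k).filter fun K => ∀ m, k ≤ m → K ∈ A.T m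

/-- Ω_k^0 : the union of the patches of the elements of T k refined at some later stage. -/
def Omega0 (A : AFEM d Ω p γ) (k : ℕ) : Set (E d) :=
  ⋃ K ∈ {K | K ∈ A.T k ∧ ∃ m, k ≤ m ∧ K ∉ A.T m}, patch d (A.T k) K

/-- ‖h_j‖_{L^∞(S)} : sup of the mesh sizes of elements of T j meeting S. -/
def meshSizeSupOn (A : AFEM d Ω p γ) (j : ℕ) (S : Set (E d)) : ℝ :=
  sSup (meshSize d '' {K | K ∈ A.T j ∧ (K ∩ S).Nonempty})

/-! ### Elementary real inequalities -/

theorem rpow_sub_two_mul_self {a r : ℝ} (ha : 0 ≤ a) (hr : 1 < r) :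
    a ^ (r - 2) * a = a ^ (r - 1) := by
  rcases ha.eq_or_lt with rfl | ha
  · rw [mul_zero, Real.zero_rpow (by linarith)]
  · rw [← Real.rpow_add_one ha.ne']
    congr 1
    ring

theorem norm_flux (d : ℕ) {p : ℝ} (hp : 1 < p) (v : E d) : ‖flux d p v‖ = ‖v‖ ^ (p - 1) := by
  rw [flux, norm_smul, Real.norm_of_nonneg (by positivity),
    rpow_sub_two_mul_self (norm_nonneg v) hp]

theorem rpow_sub_one_rpow_conj {a p : ℝ} (ha : 0 ≤ a) (hp : 1 < p) :
    (a ^ (p - 1)) ^ (p / (p - 1)) = a ^ p := by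
  rw [← Real.rpow_mul ha]
  congr 1
  field_simp [show p - 1 ≠ 0 by linarith]

theorem norm_sub_rpow_le {V : Type*} [SeminormedAddCommGroup V] {q : ℝ} (hq : 0 ≤ q) (a b : V) :
    ‖a - b‖ ^ q ≤ 2 ^ q * (‖a‖ ^ q + ‖b‖ ^ q) := by
  have h : ‖a - b‖ ≤ 2 * max ‖a‖ ‖b‖ := by
    linarith [norm_sub_le a b, le_max_left ‖a‖ ‖b‖, le_max_right ‖a‖ ‖b‖]
  calc ‖a - b‖ ^ q ≤ (2 * max ‖a‖ ‖b‖) ^ q := Real.rpow_le_rpow (norm_nonneg _) h hq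
    _ = 2 ^ q * max ‖a‖ ‖b‖ ^ q := Real.mul_rpow (by norm_num) (by positivity)
    _ ≤ 2 ^ q * (‖a‖ ^ q + ‖b‖ ^ q) := by
      gcongr
      have := Real.rpow_nonneg (norm_nonneg a) q
      have := Real.rpow_nonneg (norm_nonneg b) q
      rcases max_choice ‖a‖ ‖b‖ with h | h <;> rw [h] <;> linarith

theorem norm_flux_sub_rpow_le (d : ℕ) {p : ℝ} (hp : 1 < p) (v w : E d) :
    ‖flux d p v - flux d p w‖ ^ (p / (p - 1))
      ≤ 2 ^ (p / (p - 1)) * (‖v‖ ^ p + ‖w‖ ^ p) := by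
  have hq : 0 ≤ p / (p - 1) := div_nonneg (by linarith) (by linarith)
  have h := norm_sub_rpow_le hq (flux d p v) (flux d p w)
  rwa [norm_flux d hp, norm_flux d hp, rpow_sub_one_rpow_conj (norm_nonneg _) hp,
    rpow_sub_one_rpow_conj (norm_nonneg _) hp] at h

theorem abs_mul_rpow_conj {a p m : ℝ} (hp : 1 < p) (hm : 0 ≤ m) :
    |m * |a| ^ (p - 2) * a| ^ (p / (p - 1)) = m ^ (p / (p - 1)) * |a| ^ p := by
  rw [abs_mul, abs_mul, abs_of_nonneg hm, abs_of_nonneg (Real.rpow_nonneg (abs_nonneg a) _),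
    mul_assoc, rpow_sub_two_mul_self (abs_nonneg a) hp,
    Real.mul_rpow hm (Real.rpow_nonneg (abs_nonneg a) _),
    rpow_sub_one_rpow_conj (abs_nonneg a) hp]

/-! ### Size of faces -/

theorem hausdorffMeasure_face_le (n : ℕ) {F : Set (E (n + 1))} (hF : IsFaceSimplex (n + 1) F) :
    μH[(n : ℝ)] F ≤ ENNReal.ofReal ((2 * n * diam F) ^ n) := by
  obtain ⟨w, hw, rfl⟩ := hF
  have hrank : Module.finrank ℝ (vectorSpan ℝ (Set.range w)) = n :=
    hw.finrank_vectorSpan (by simp)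
  set F := convexHull ℝ (Set.range w) with hFdef
  have hbdd : Bornology.IsBounded F :=
    ((Set.finite_range w).isCompact_convexHull ℝ).isBounded
  have hw0 : w 0 ∈ F := subset_convexHull ℝ _ ⟨0, rfl⟩
  let b := (stdOrthonormalBasis ℝ (vectorSpan ℝ (Set.range w))).reindex (finCongr hrank)
  let f : (Fin n → ℝ) → E (n + 1) := fun t => w 0 + ∑ i, t i • (b i : E (n + 1))
  have hb : ∀ i, ‖(b i : E (n + 1))‖ = 1 := fun i => b.orthonormal.1 i
  have hf : LipschitzWith n f := by
    refine LipschitzWith.of_dist_le_mul fun s t => ?_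
    have : f s - f t = ∑ i, (s i - t i) • (b i : E (n + 1)) := by
      simp only [f, sub_smul, Finset.sum_sub_distrib]
      abel
    rw [dist_eq_norm, this]
    calc ‖∑ i, (s i - t i) • (b i : E (n + 1))‖
        ≤ ∑ i : Fin n, ‖(s i - t i) • (b i : E (n + 1))‖ := norm_sum_le _ _
      _ ≤ ∑ _i : Fin n, dist s t := by
        refine Finset.sum_le_sum fun i _ => ?_
        rw [norm_smul, hb, mul_one, ← dist_eq_norm]
        exact dist_le_pi_dist s t i
      _ = (n : NNReal) * dist s t := by simp
  have hsub : F ⊆ f '' closedBall 0 (diam F) := by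
    intro x hx
    have hmem : x - w 0 ∈ vectorSpan ℝ (Set.range w) :=
      vsub_mem_vectorSpan_of_mem_affineSpan_of_mem_affineSpan
        (convexHull_subset_affineSpan _ hx) (convexHull_subset_affineSpan _ hw0)
    let y : vectorSpan ℝ (Set.range w) := ⟨x - w 0, hmem⟩
    have hy : ‖y‖ ≤ diam F := by
      change ‖x - w 0‖ ≤ _
      rw [← dist_eq_norm]
      exact dist_le_diam_of_mem hbdd hx hw0
    refine ⟨fun i => b.repr y i, ?_, ?_⟩
    · rw [mem_closedBall_zero_iff, pi_norm_le_iff_of_nonneg diam_nonneg]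
      intro i
      exact ((PiLp.norm_apply_le (b.repr y) i).trans_eq (b.repr.norm_map y)).trans hy
    · have h := congrArg (Subtype.val) (b.sum_repr y)
      simp only [Submodule.coe_sum, Submodule.coe_smul] at h
      simp only [f]
      rw [h]
      simp [y]
  have hvol : μH[(n : ℝ)] (closedBall (0 : Fin n → ℝ) (diam F))
      = ENNReal.ofReal ((2 * diam F) ^ n) := by
    have h1 : μH[(n : ℝ)] = (volume : Measure (Fin n → ℝ)) := by
      simpa using hausdorffMeasure_pi_real (ι := Fin n)
    rw [h1, Real.volume_pi_closedBall _ diam_nonneg, Fintype.card_fin]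
  calc μH[(n : ℝ)] F ≤ μH[(n : ℝ)] (f '' closedBall 0 (diam F)) := measure_mono hsub
    _ ≤ ((n : NNReal) : ℝ≥0∞) ^ (n : ℝ) * μH[(n : ℝ)] (closedBall (0 : Fin n → ℝ) (diam F)) :=
      hf.hausdorffMeasure_image_le (Nat.cast_nonneg n) _
    _ = ENNReal.ofReal ((2 * n * diam F) ^ n) := by
      rw [hvol, ENNReal.rpow_natCast, ENNReal.coe_natCast, ← ENNReal.ofReal_natCast,
        ← ENNReal.ofReal_pow (Nat.cast_nonneg n), ← ENNReal.ofReal_mul (by positivity)]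
      congr 1
      rw [← mul_pow]
      ring

theorem faceSize_mul_measure_le (n : ℕ) (hn : n ≠ 0) {F : Set (E (n + 1))}
    (hF : IsFaceSimplex (n + 1) F) {R : ℝ} (hR : diam F ≤ R) :
    faceSize (n + 1) F * (μH[(((n + 1 : ℕ) : ℝ)) - 1]).real F ≤ (2 * n * R) ^ (n + 1) := by
  have hcast : ((n + 1 : ℕ) : ℝ) - 1 = n := by push_cast; ring
  have hR0 : 0 ≤ R := diam_nonneg.trans hR
  have hH : (μH[(n : ℝ)]).real F ≤ (2 * n * R) ^ n := by
    refine (ENNReal.toReal_le_of_le_ofReal (by positivity) (hausdorffMeasure_face_le n hF)).trans ?_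
    gcongr
  have hs : faceSize (n + 1) F ≤ 2 * n * R := by
    rw [faceSize, hcast, one_div]
    refine (Real.rpow_le_rpow ENNReal.toReal_nonneg hH (by positivity)).trans_eq ?_
    exact Real.pow_rpow_inv_natCast (by positivity) hn
  rw [hcast, pow_succ']
  exact mul_le_mul hs hH measureReal_nonneg (by positivity)

/-- A flux jump is controlled by the gradients on the two sides, weighted by the size of any
number dominating the diameter of the face. -/
theorem face_jump_le (n : ℕ) (hn : n ≠ 0) {p : ℝ} (hp : 1 < p) {F : Set (E (n + 1))}
    (hF : IsFaceSimplex (n + 1) F) {R : ℝ} (hR : diam F ≤ R) (v w : E (n + 1)) :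
    faceSize (n + 1) F *
        ∫ _ in F, ‖flux (n + 1) p v - flux (n + 1) p w‖ ^ (p / (p - 1))
          ∂μH[((n + 1 : ℕ) : ℝ) - 1]
      ≤ (2 * n) ^ (n + 1) * 2 ^ (p / (p - 1)) * (R ^ (n + 1) * (‖v‖ ^ p + ‖w‖ ^ p)) := by
  have hR0 : 0 ≤ R := diam_nonneg.trans hR
  rw [setIntegral_const, smul_eq_mul, ← mul_assoc]
  calc _ ≤ (2 * n * R) ^ (n + 1) * (2 ^ (p / (p - 1)) * (‖v‖ ^ p + ‖w‖ ^ p)) :=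
        mul_le_mul (faceSize_mul_measure_le n hn hF hR) (norm_flux_sub_rpow_le _ hp v w)
          (by positivity) (by positivity)
    _ = _ := by rw [mul_pow]; ring

/-! ### Packing of shape-regular elements -/

theorem measureReal_ball (d : ℕ) (hd : 0 < d) (x : E d) {r : ℝ} (hr : 0 ≤ r) :
    (volume : Measure (E d)).real (ball x r) = r ^ d * volume.real (ball (0 : E d) 1) := by
  have : Nonempty (Fin d) := ⟨⟨0, hd⟩⟩
  rw [measureReal_def, Measure.addHaar_ball _ _ hr, ENNReal.toReal_mul,
    ENNReal.toReal_ofReal (by positivity), finrank_euclideanSpace_fin, measureReal_def]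

theorem measureReal_unitBall_pos (d : ℕ) : 0 < (volume : Measure (E d)).real (ball 0 1) :=
  ENNReal.toReal_pos (measure_ball_pos _ _ one_pos).ne' measure_ball_lt_top.ne

/-- The elements are `γ`-shape-regular compact convex sets. -/
def IsRegularElement (d : ℕ) (γ : ℝ) (K : Set (E d)) : Prop :=
  Convex ℝ K ∧ IsCompact K ∧ ∃ x r, 0 < r ∧ ball x r ⊆ K ∧ diam K ≤ γ * r

theorem IsRegularElement.diam_pow_le {d : ℕ} (hd : 0 < d) {γ : ℝ} (hγ : 0 < γ) {K : Set (E d)}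
    (hK : IsRegularElement d γ K) :
    diam K ^ d ≤ γ ^ d / volume.real (ball (0 : E d) 1) * volume.real K := by
  obtain ⟨-, hc, x, r, hr, hball, hdiam⟩ := hK
  have hω := measureReal_unitBall_pos d
  have h := measureReal_mono (μ := volume) hball hc.measure_lt_top.ne
  rw [measureReal_ball d hd x hr.le] at h
  calc diam K ^ d ≤ (γ * r) ^ d := by gcongr
    _ = γ ^ d / volume.real (ball (0 : E d) 1) * (r ^ d * volume.real (ball (0 : E d) 1)) := by
      rw [mul_pow]
      field_simp
    _ ≤ _ := by gcongr

/-- A regular element contains, near each of its points, a ball of any smaller admissible size. -/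
theorem IsRegularElement.exists_ball_subset {d : ℕ} {γ : ℝ} (hγ : 0 < γ) {K : Set (E d)}
    (hK : IsRegularElement d γ K) {y : E d} (hy : y ∈ K) {ρ : ℝ} (hρ : 0 ≤ ρ)
    (hρK : ρ ≤ diam K) : ∃ z, dist z y ≤ ρ ∧ ball z (ρ / γ) ⊆ K := by
  obtain ⟨hconv, hc, x, r, hr, hball, hdiam⟩ := hK
  rcases hρ.eq_or_lt with rfl | hρ0
  · exact ⟨y, by simp, by simp⟩
  set t := ρ / (γ * r) with ht
  have htpos : 0 < t := by positivity
  have ht1 : t ≤ 1 := (div_le_one (by positivity)).2 (hρK.trans hdiam)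
  have htr : ρ / γ = t * r := by rw [ht]; field_simp
  have hxK : x ∈ K := hball (mem_ball_self hr)
  refine ⟨y + t • (x - y), ?_, ?_⟩
  · rw [dist_eq_norm, add_sub_cancel_left, norm_smul, Real.norm_of_nonneg htpos.le,
      ← dist_eq_norm]
    calc t * dist x y ≤ t * (γ * r) := by
          gcongr
          exact (dist_le_diam_of_mem hc.isBounded hxK hy).trans hdiam
      _ = ρ := by rw [ht]; field_simp
  · intro w hw
    set v := x + t⁻¹ • (w - (y + t • (x - y))) with hv
    have hvK : v ∈ K := by
      apply hball
      rw [mem_ball, dist_eq_norm, hv, add_sub_cancel_left, norm_smul, norm_inv,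
        Real.norm_of_nonneg htpos.le, ← dist_eq_norm, inv_mul_lt_iff₀ htpos, ← htr]
      exact hw
    have hwv : w = (1 - t) • y + t • v := by
      rw [hv, smul_add, smul_smul, mul_inv_cancel₀ htpos.ne', one_smul, sub_smul, one_smul,
        smul_sub]
      abel
    rw [hwv]
    exact hconv hy hvK (by linarith) htpos.le (by ring)

/-- The weight coupling two touching elements: the `d`-th power of the smaller diameter. -/
def touchWeight (d : ℕ) (K K' : Set (E d)) : ℝ :=
  if (K ∩ K').Nonempty then min (diam K) (diam K') ^ d else 0

theorem touchWeight_nonneg (d : ℕ) (K K' : Set (E d)) : 0 ≤ touchWeight d K K' := by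
  rw [touchWeight]
  split_ifs
  · exact pow_nonneg (le_min diam_nonneg diam_nonneg) _
  · exact le_rfl

theorem touchWeight_comm (d : ℕ) (K K' : Set (E d)) :
    touchWeight d K K' = touchWeight d K' K := by
  rw [touchWeight, touchWeight, Set.inter_comm, min_comm]

theorem sum_touchWeight_le {d : ℕ} (hd : 0 < d) {γ : ℝ} (hγ : 0 < γ) {T : Finset (Set (E d))}
    (hreg : ∀ K ∈ T, IsRegularElement d γ K)
    (hdisj : ∀ K ∈ T, ∀ K' ∈ T, K ≠ K' → interior K ∩ interior K' = ∅)
    {K : Set (E d)} (hK : K ∈ T) :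
    ∑ K' ∈ T, touchWeight d K K' ≤
      (2 * γ + 1) ^ d * (γ ^ d / volume.real (ball (0 : E d) 1)) * volume.real K := by
  have hω := measureReal_unitBall_pos d
  have hδ : 0 ≤ diam K := diam_nonneg
  obtain ⟨x, r, hr, hball, -⟩ := (hreg K hK).2.2
  have hKb := (hreg K hK).2.1.isBounded
  have hxK : x ∈ K := hball (mem_ball_self hr)
  set S := T.filter fun K' => (K ∩ K').Nonempty with hS
  have hρ0 : ∀ K' : Set (E d), 0 ≤ min (diam K) (diam K') := fun K' =>
    le_min diam_nonneg diam_nonneg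
  have hex : ∀ K' : Set (E d), ∃ z, K' ∈ S →
      dist z x ≤ 2 * diam K ∧ ball z (min (diam K) (diam K') / γ) ⊆ K' := by
    intro K'
    by_cases h : K' ∈ S
    · obtain ⟨hT, y, hyK, hyK'⟩ := Finset.mem_filter.1 h
      obtain ⟨z, hz, hzb⟩ := (hreg K' hT).exists_ball_subset hγ hyK' (hρ0 K') (min_le_right _ _)
      refine ⟨z, fun _ => ⟨?_, hzb⟩⟩
      have h1 := dist_triangle z y x
      have h2 := dist_le_diam_of_mem hKb hyK hxK
      have h3 := min_le_left (diam K) (diam K')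
      linarith
    · exact ⟨0, fun h' => absurd h' h⟩
  choose z hz using hex
  let B : Set (E d) → Set (E d) := fun K' => ball (z K') (min (diam K) (diam K') / γ)
  have hBint : ∀ K' ∈ S, B K' ⊆ interior K' := fun K' h =>
    interior_maximal (hz K' h).2 isOpen_ball
  have hBdisj : (S : Set (Set (E d))).PairwiseDisjoint B := by
    intro K₁ h₁ K₂ h₂ hne
    refine Disjoint.mono (hBint K₁ h₁) (hBint K₂ h₂) (Set.disjoint_iff_inter_eq_empty.2 ?_)
    exact hdisj K₁ (Finset.mem_filter.1 h₁).1 K₂ (Finset.mem_filter.1 h₂).1 hne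
  have hBsub : ⋃ K' ∈ S, B K' ⊆ closedBall x ((2 + 1 / γ) * diam K) := by
    refine Set.iUnion₂_subset fun K' h w hw => ?_
    have h1 := dist_triangle w (z K') x
    have h2 : dist w (z K') < min (diam K) (diam K') / γ := hw
    have h3 : min (diam K) (diam K') / γ ≤ diam K / γ := by gcongr; exact min_le_left _ _
    have h4 := (hz K' h).1
    rw [mem_closedBall]
    calc dist w x ≤ diam K / γ + 2 * diam K := by linarith
      _ = (2 + 1 / γ) * diam K := by ring
  have hvol := measureReal_mono (μ := volume) hBsub measure_closedBall_lt_top.ne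
  rw [measureReal_biUnion_finset hBdisj (fun _ _ => measurableSet_ball)
    (fun _ _ => measure_ball_lt_top.ne),
    Measure.addHaar_real_closedBall _ _ (by positivity), finrank_euclideanSpace_fin] at hvol
  have hB : ∀ K', volume.real (B K') = (min (diam K) (diam K') / γ) ^ d *
      volume.real (ball (0 : E d) 1) := fun K' =>
    measureReal_ball d hd _ (div_nonneg (hρ0 K') hγ.le)
  simp only [hB, ← Finset.sum_mul] at hvol
  have hvol' := le_of_mul_le_mul_right hvol hω
  have hsum : ∑ K' ∈ T, touchWeight d K K' = γ ^ d *
      ∑ K' ∈ S, (min (diam K) (diam K') / γ) ^ d := by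
    rw [Finset.mul_sum, hS, Finset.sum_filter]
    refine Finset.sum_congr rfl fun K' _ => ?_
    rw [touchWeight]
    split_ifs
    · rw [div_pow]; field_simp
    · rfl
  calc ∑ K' ∈ T, touchWeight d K K' ≤ γ ^ d * ((2 + 1 / γ) * diam K) ^ d := by
        rw [hsum]; gcongr
    _ = (2 * γ + 1) ^ d * diam K ^ d := by
        rw [← mul_pow, ← mul_pow]; congr 1; field_simp
    _ ≤ _ := by
        rw [mul_assoc]
        gcongr
        exact (hreg K hK).diam_pow_le hd hγ

theorem touchWeight_le {d : ℕ} (hd : 0 < d) {γ : ℝ} (hγ : 0 < γ) (K : Set (E d)) {K' : Set (E d)}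
    (hreg : IsRegularElement d γ K') :
    touchWeight d K K' ≤ γ ^ d / volume.real (ball (0 : E d) 1) * volume.real K' := by
  rw [touchWeight]
  split_ifs
  · refine le_trans ?_ (hreg.diam_pow_le hd hγ)
    exact pow_le_pow_left₀ (le_min diam_nonneg diam_nonneg) (min_le_right _ _) d
  · positivity

/-! ### Integrals over elements with disjoint interiors -/

theorem sum_setIntegral_le {d : ℕ} {γ : ℝ} {S : Finset (Set (E d))} {B : Set (E d)}
    (hreg : ∀ K ∈ S, IsRegularElement d γ K)
    (hdisj : ∀ K ∈ S, ∀ K' ∈ S, K ≠ K' → interior K ∩ interior K' = ∅)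
    (hB : ⋃ K ∈ S, K = B) {f : E d → ℝ} (hf : ∀ x, 0 ≤ f x)
    (hint : ∀ K ∈ S, IntegrableOn f K) :
    ∑ K ∈ S, ∫ x in K, f x ≤ ∫ x in B, f x := by
  have h1 : ∀ K ∈ S, ∫ x in K, f x = ∫ x in interior K, f x := fun K hK =>
    (setIntegral_congr_set
      (interior_ae_eq_of_null_frontier ((hreg K hK).1.addHaar_frontier _))).symm
  rw [Finset.sum_congr rfl h1, ← integral_biUnion_finset S (fun _ _ => isOpen_interior.measurableSet)
    (fun K hK K' hK' hne => Set.disjoint_iff_inter_eq_empty.2 (hdisj K hK K' hK' hne))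
    (fun K hK => (hint K hK).mono_set interior_subset)]
  refine setIntegral_mono_set ?_ (Eventually.of_forall hf) (LE.le.eventuallyLE ?_)
  · rw [← hB]
    exact integrableOn_finset_iUnion.2 hint
  · rw [← hB]
    exact Set.iUnion₂_mono fun K _ => interior_subset

theorem patch_eq {d : ℕ} (T : Finset (Set (E d))) (K : Set (E d)) :
    ⋃ K' ∈ T.filter (fun K' => (K ∩ K').Nonempty), K' = patch d T K := by
  ext x
  simp [patch, and_assoc, and_left_comm]

/-! ### Piecewise affine functions -/

theorem gradient_eq_of_mem_interior {d : ℕ} {u : E d → ℝ} {v : E d} {c : ℝ} {K : Set (E d)}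
    (h : ∀ x ∈ K, u x = ⟪v, x⟫ + c) {x : E d} (hx : x ∈ interior K) : gradient u x = v := by
  have h1 : HasGradientAt (fun y : E d => ⟪v, y⟫ + c) v x := by
    rw [hasGradientAt_iff_hasFDerivAt]
    exact ((InnerProductSpace.toDual ℝ (E d) v).hasFDerivAt).add_const c
  have h2 : u =ᶠ[𝓝 x] fun y : E d => ⟪v, y⟫ + c := by
    filter_upwards [mem_interior_iff_mem_nhds.1 hx] with y hy using h y hy
  exact (h1.congr_of_eventuallyEq h2).gradient

theorem volume_inner_add_eq_zero {d : ℕ} {v : E d} (hv : v ≠ 0) (c : ℝ) :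
    volume {x : E d | ⟪v, x⟫ + c = 0} = 0 := by
  let s : AffineSubspace ℝ (E d) :=
    { carrier := {x : E d | ⟪v, x⟫ + c = 0}
      smul_vsub_vadd_mem' := by
        intro t x y z hx hy hz
        simp only [Set.mem_ofPred_eq, vsub_eq_sub, vadd_eq_add, inner_add_right, inner_smul_right,
          inner_sub_right] at *
        linear_combination t * hx - t * hy + hz }
  refine Measure.addHaar_affineSubspace volume s fun h => ?_
  have h0 : (0 : E d) ∈ s := h ▸ AffineSubspace.mem_top ℝ _ _
  have hv' : v ∈ s := h ▸ AffineSubspace.mem_top ℝ _ _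
  have h0' : ⟪v, (0 : E d)⟫ + c = 0 := h0
  have hv'' : ⟪v, v⟫ + c = 0 := hv'
  rw [inner_zero_right] at h0'
  rw [show c = 0 by linarith, add_zero, inner_self_eq_zero] at hv''
  exact hv hv''

theorem ae_mem_interior {d : ℕ} {K : Set (E d)} (hconv : Convex ℝ K) (hm : MeasurableSet K) :
    ∀ᵐ x ∂volume.restrict K, x ∈ interior K := by
  have h := interior_ae_eq_of_null_frontier (hconv.addHaar_frontier volume)
  rw [ae_restrict_iff' hm]
  filter_upwards [h.mem_iff] with x hx hxK using hx.2 hxK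

theorem gradient_rpow_ae_eq {d : ℕ} {u : E d → ℝ} {v : E d} {c p : ℝ} {K : Set (E d)}
    (hconv : Convex ℝ K) (hm : MeasurableSet K) (h : ∀ x ∈ K, u x = ⟪v, x⟫ + c) :
    (fun x => ‖gradient u x‖ ^ p) =ᵐ[volume.restrict K] fun _ => ‖v‖ ^ p := by
  filter_upwards [ae_mem_interior hconv hm] with x hx
  rw [gradient_eq_of_mem_interior h hx]

theorem setIntegral_gradient_rpow {d : ℕ} {u : E d → ℝ} {v : E d} {c p : ℝ} {K : Set (E d)}
    (hconv : Convex ℝ K) (hm : MeasurableSet K) (h : ∀ x ∈ K, u x = ⟪v, x⟫ + c) :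
    ∫ x in K, ‖gradient u x‖ ^ p = volume.real K * ‖v‖ ^ p := by
  rw [integral_congr_ae (gradient_rpow_ae_eq hconv hm h), setIntegral_const, smul_eq_mul]

theorem integrableOn_gradient_rpow {d : ℕ} {u : E d → ℝ} {v : E d} {c p : ℝ} {K : Set (E d)}
    (hconv : Convex ℝ K) (hc : IsCompact K) (h : ∀ x ∈ K, u x = ⟪v, x⟫ + c) :
    IntegrableOn (fun x => ‖gradient u x‖ ^ p) K :=
  (integrableOn_const hc.measure_lt_top.ne).congr
    (gradient_rpow_ae_eq hconv hc.measurableSet h).symm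

/-- The gradient of an affine piece vanishes almost everywhere off any set outside which the
function vanishes. -/
theorem gradient_rpow_ae_eq_indicator {d : ℕ} {Ω : Set (E d)} {u : E d → ℝ} {v : E d}
    {c p : ℝ} (hp : 1 < p) {K : Set (E d)} (hconv : Convex ℝ K) (hm : MeasurableSet K)
    (h : ∀ x ∈ K, u x = ⟪v, x⟫ + c) (h0 : ∀ x ∉ Ω, u x = 0) :
    (fun x => ‖gradient u x‖ ^ p) =ᵐ[volume.restrict K]
      Ω.indicator fun x => ‖gradient u x‖ ^ p := by
  by_cases hv : v = 0
  · filter_upwards [ae_mem_interior hconv hm] with x hx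
    by_cases hxΩ : x ∈ Ω
    · rw [Set.indicator_of_mem hxΩ]
    · rw [Set.indicator_of_notMem hxΩ, gradient_eq_of_mem_interior h hx, hv, norm_zero,
        Real.zero_rpow (by linarith)]
  · have hnull : ∀ᵐ x ∂volume.restrict K, ¬ ⟪v, x⟫ + c = 0 := by
      refine ae_restrict_of_ae (ae_iff.2 ?_)
      simpa using volume_inner_add_eq_zero hv c
    filter_upwards [ae_restrict_mem hm, hnull] with x hx hne
    have hxΩ : x ∈ Ω := by
      by_contra hxΩ
      exact hne ((h x hx).symm.trans (h0 x hxΩ))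
    rw [Set.indicator_of_mem hxΩ]

/-! ### The estimator on one mesh -/

theorem IsSimplex.convex {d : ℕ} {K : Set (E d)} (hK : IsSimplex d K) : Convex ℝ K := by
  obtain ⟨v, -, rfl⟩ := hK
  exact convex_convexHull ℝ _

theorem IsSimplex.isCompact {d : ℕ} {K : Set (E d)} (hK : IsSimplex d K) : IsCompact K := by
  obtain ⟨v, -, rfl⟩ := hK
  exact (Set.finite_range v).isCompact_convexHull ℝ

theorem integrableOn_abs_rpow {d : ℕ} {u : E d → ℝ} {v : E d} {c p : ℝ} (hp : 0 ≤ p)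
    {K : Set (E d)} (hc : IsCompact K) (h : ∀ x ∈ K, u x = ⟪v, x⟫ + c) :
    IntegrableOn (fun x => |u x| ^ p) K := by
  have hcont : Continuous fun x : E d => |⟪v, x⟫ + c| ^ p :=
    ((by fun_prop : Continuous fun x : E d => |⟪v, x⟫ + c|)).rpow_const fun _ => Or.inr hp
  exact (hcont.continuousOn.integrableOn_compact hc).congr_fun
    (fun x hx => by simp only [h x hx]) hc.measurableSet

/-- The local indicator is bounded by the weighted `L^p`-norm and the coupled gradients. -/
theorem etaQLoc_le (n : ℕ) (hn : n ≠ 0) (Ω : Set (E (n + 1))) {p : ℝ} (hp : 1 < p)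
    {T : Finset (Set (E (n + 1)))} (hcomp : ∀ K ∈ T, IsCompact K)
    (g : Set (E (n + 1)) → E (n + 1)) {m : ℝ} (hm : 0 ≤ m) (u : E (n + 1) → ℝ)
    {K : Set (E (n + 1))} (hK : K ∈ T) :
    etaQLoc (n + 1) Ω p T g m u K ≤
      m ^ (p / (p - 1)) * (meshSize (n + 1) K ^ (p / (p - 1)) * ∫ x in K, |u x| ^ p)
      + (2 * n) ^ (n + 1) * 2 ^ (p / (p - 1)) *
        ∑ K' ∈ T, touchWeight (n + 1) K K' * (‖g K‖ ^ p + ‖g K'‖ ^ p) := by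
  rw [etaQLoc]
  refine add_le_add (le_of_eq ?_) ?_
  · simp only [abs_mul_rpow_conj hp hm]
    rw [integral_const_mul]
    ring
  · rw [Finset.mul_sum]
    refine Finset.sum_le_sum fun K' hK' => ?_
    split_ifs with h
    · obtain ⟨-, hF, -⟩ := h
      have hne : (K ∩ K').Nonempty := by
        obtain ⟨w, -, hw⟩ := hF
        exact ⟨w 0, hw ▸ subset_convexHull ℝ _ ⟨0, rfl⟩⟩
      rw [touchWeight, if_pos hne]
      exact face_jump_le n hn hp hF (le_min
        (diam_mono Set.inter_subset_left (hcomp K hK).isBounded)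
        (diam_mono Set.inter_subset_right (hcomp K' hK').isBounded)) _ _
    · have := touchWeight_nonneg (n + 1) K K'
      positivity

theorem etaQLoc_nonneg (d : ℕ) (Ω : Set (E d)) (p : ℝ) (T : Finset (Set (E d)))
    (g : Set (E d) → E d) (m : ℝ) (u : E d → ℝ) (K : Set (E d)) :
    0 ≤ etaQLoc d Ω p T g m u K := by
  rw [etaQLoc, meshSize]
  refine add_nonneg (mul_nonneg (by positivity) (integral_nonneg fun x => by positivity))
    (Finset.sum_nonneg fun K' _ => ?_)
  split_ifs
  · rw [faceSize]
    exact mul_nonneg (by positivity) (integral_nonneg fun x => by positivity)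
  · exact le_rfl

/-- The coupled gradients at `K` are bounded by the gradient energy on the patch of `K`. -/
theorem sum_touchWeight_mul_le_patch {d : ℕ} (hd : 0 < d) {γ : ℝ} (hγ : 0 < γ) {p : ℝ}
    {T : Finset (Set (E d))} (hreg : ∀ K ∈ T, IsRegularElement d γ K)
    (hdisj : ∀ K ∈ T, ∀ K' ∈ T, K ≠ K' → interior K ∩ interior K' = ∅)
    {u : E d → ℝ} {g : Set (E d) → E d}
    (hg : ∀ K ∈ T, ∃ c : ℝ, ∀ x ∈ K, u x = ⟪g K, x⟫ + c) {K : Set (E d)} (hK : K ∈ T) :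
    ∑ K' ∈ T, touchWeight d K K' * (‖g K‖ ^ p + ‖g K'‖ ^ p) ≤
      ((2 * γ + 1) ^ d * (γ ^ d / volume.real (ball (0 : E d) 1))
        + γ ^ d / volume.real (ball (0 : E d) 1)) *
      ∫ x in patch d T K, ‖gradient u x‖ ^ p := by
  set S := T.filter fun K' => (K ∩ K').Nonempty with hS
  have hST : ∀ K' ∈ S, K' ∈ T := fun K' h => (Finset.mem_filter.1 h).1
  have hval : ∀ K' ∈ T, ∫ x in K', ‖gradient u x‖ ^ p = volume.real K' * ‖g K'‖ ^ p := by
    intro K' h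
    obtain ⟨c, hc⟩ := hg K' h
    exact setIntegral_gradient_rpow (hreg K' h).1 (hreg K' h).2.1.measurableSet hc
  have hpatch : ∑ K' ∈ S, volume.real K' * ‖g K'‖ ^ p ≤
      ∫ x in patch d T K, ‖gradient u x‖ ^ p := by
    rw [← Finset.sum_congr rfl fun K' h => hval K' (hST K' h)]
    refine sum_setIntegral_le (fun K' h => hreg K' (hST K' h))
      (fun K₁ h₁ K₂ h₂ => hdisj K₁ (hST K₁ h₁) K₂ (hST K₂ h₂)) (patch_eq T K)
      (fun x => by positivity) fun K' h => ?_
    obtain ⟨c, hc⟩ := hg K' (hST K' h)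
    exact integrableOn_gradient_rpow (hreg K' (hST K' h)).1 (hreg K' (hST K' h)).2.1 hc
  have hKS : K ∈ S := by
    obtain ⟨x, r, hr, hball, -⟩ := (hreg K hK).2.2
    exact Finset.mem_filter.2 ⟨hK, x, hball (mem_ball_self hr), hball (mem_ball_self hr)⟩
  have hown : volume.real K * ‖g K‖ ^ p ≤ ∫ x in patch d T K, ‖gradient u x‖ ^ p :=
    (Finset.single_le_sum (f := fun K' => volume.real K' * ‖g K'‖ ^ p)
      (fun _ _ => by positivity) hKS).trans hpatch
  have hω := measureReal_unitBall_pos d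
  simp only [mul_add, Finset.sum_add_distrib]
  rw [add_mul]
  refine add_le_add ?_ ?_
  · rw [← Finset.sum_mul]
    calc _ ≤ (2 * γ + 1) ^ d * (γ ^ d / volume.real (ball (0 : E d) 1)) * volume.real K
          * ‖g K‖ ^ p := by
          gcongr
          exact sum_touchWeight_le hd hγ hreg hdisj hK
      _ = (2 * γ + 1) ^ d * (γ ^ d / volume.real (ball (0 : E d) 1)) *
          (volume.real K * ‖g K‖ ^ p) := by ring
      _ ≤ _ := by gcongr
  · have hres : ∑ K' ∈ T, touchWeight d K K' * ‖g K'‖ ^ p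
        = ∑ K' ∈ S, touchWeight d K K' * ‖g K'‖ ^ p := by
      rw [hS, Finset.sum_filter]
      refine Finset.sum_congr rfl fun K' _ => ?_
      split_ifs with h
      · rfl
      · rw [touchWeight, if_neg h, zero_mul]
    rw [hres]
    calc _ ≤ ∑ K' ∈ S, γ ^ d / volume.real (ball (0 : E d) 1) *
          (volume.real K' * ‖g K'‖ ^ p) := by
          refine Finset.sum_le_sum fun K' h => ?_
          rw [← mul_assoc]
          gcongr
          exact touchWeight_le hd hγ K (hreg K' (hST K' h))
      _ ≤ _ := by
          rw [← Finset.mul_sum]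
          gcongr

/-- By symmetry of the coupling, the coupled gradients sum up to at most a multiple of the total
gradient energy, without any bound on the overlap of the patches. -/
theorem sum_sum_touchWeight_mul_le {d : ℕ} (hd : 0 < d) {γ : ℝ} (hγ : 0 < γ) {p : ℝ}
    {T : Finset (Set (E d))} (hreg : ∀ K ∈ T, IsRegularElement d γ K)
    (hdisj : ∀ K ∈ T, ∀ K' ∈ T, K ≠ K' → interior K ∩ interior K' = ∅)
    (g : Set (E d) → E d) :
    ∑ K ∈ T, ∑ K' ∈ T, touchWeight d K K' * (‖g K‖ ^ p + ‖g K'‖ ^ p) ≤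
      2 * ((2 * γ + 1) ^ d * (γ ^ d / volume.real (ball (0 : E d) 1))) *
      ∑ K ∈ T, volume.real K * ‖g K‖ ^ p := by
  have hsymm : ∑ K ∈ T, ∑ K' ∈ T, touchWeight d K K' * ‖g K'‖ ^ p
      = ∑ K ∈ T, ∑ K' ∈ T, touchWeight d K K' * ‖g K‖ ^ p := by
    rw [Finset.sum_comm]
    refine Finset.sum_congr rfl fun K _ => Finset.sum_congr rfl fun K' _ => ?_
    rw [touchWeight_comm]
  simp only [mul_add, Finset.sum_add_distrib]
  rw [hsymm, ← two_mul, mul_assoc]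
  refine mul_le_mul_of_nonneg_left ?_ (by norm_num)
  rw [Finset.mul_sum]
  refine Finset.sum_le_sum fun K hK => ?_
  rw [← Finset.sum_mul, ← mul_assoc]
  gcongr
  exact sum_touchWeight_le hd hγ hreg hdisj hK

/-- The elementwise gradient energies sum up to at most the gradient energy on `Ω`. -/
theorem sum_energy_le_gradPow {d : ℕ} {Ω : Set (E d)} (hΩ : IsOpen Ω) {γ p : ℝ} (hp : 1 < p)
    {T : Finset (Set (E d))} (hreg : ∀ K ∈ T, IsRegularElement d γ K)
    (hcover : ⋃ K ∈ T, K = closure Ω)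
    (hdisj : ∀ K ∈ T, ∀ K' ∈ T, K ≠ K' → interior K ∩ interior K' = ∅)
    {u : E d → ℝ} (h0 : ∀ x ∉ Ω, u x = 0) {g : Set (E d) → E d}
    (hg : ∀ K ∈ T, ∃ c : ℝ, ∀ x ∈ K, u x = ⟪g K, x⟫ + c) :
    ∑ K ∈ T, volume.real K * ‖g K‖ ^ p ≤ gradPow d Ω p u := by
  have hval : ∀ K ∈ T, volume.real K * ‖g K‖ ^ p =
      ∫ x in K, Ω.indicator (fun x => ‖gradient u x‖ ^ p) x := by
    intro K h
    obtain ⟨c, hc⟩ := hg K h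
    have hm := (hreg K h).2.1.measurableSet
    rw [← setIntegral_gradient_rpow (hreg K h).1 hm hc]
    exact integral_congr_ae (gradient_rpow_ae_eq_indicator hp (hreg K h).1 hm hc h0)
  rw [Finset.sum_congr rfl hval]
  refine (sum_setIntegral_le hreg hdisj hcover
    (fun x => Set.indicator_nonneg (fun _ _ => by positivity) x) fun K h => ?_).trans_eq ?_
  · obtain ⟨c, hc⟩ := hg K h
    exact (integrableOn_gradient_rpow (hreg K h).1 (hreg K h).2.1 hc).congr
      (gradient_rpow_ae_eq_indicator hp (hreg K h).1 (hreg K h).2.1.measurableSet hc h0)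
  · rw [setIntegral_indicator hΩ.measurableSet, Set.inter_eq_right.2 subset_closure, gradPow]

/-- The elementwise `L^p`-norms sum up to at most the `L^p`-norm on `Ω`. -/
theorem sum_setIntegral_le_lpPow {d : ℕ} {Ω : Set (E d)} {γ p : ℝ} (hp : 0 < p)
    {T : Finset (Set (E d))} (hreg : ∀ K ∈ T, IsRegularElement d γ K)
    (hcover : ⋃ K ∈ T, K = closure Ω)
    (hdisj : ∀ K ∈ T, ∀ K' ∈ T, K ≠ K' → interior K ∩ interior K' = ∅)
    {u : E d → ℝ} (h0 : ∀ x ∉ Ω, u x = 0) {g : Set (E d) → E d}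
    (hg : ∀ K ∈ T, ∃ c : ℝ, ∀ x ∈ K, u x = ⟪g K, x⟫ + c) :
    ∑ K ∈ T, ∫ x in K, |u x| ^ p ≤ lpPow d Ω p u := by
  refine (sum_setIntegral_le hreg hdisj hcover (fun x => by positivity) fun K h => ?_).trans_eq ?_
  · obtain ⟨c, hc⟩ := hg K h
    exact integrableOn_abs_rpow hp.le (hreg K h).2.1 hc
  · refine setIntegral_eq_of_subset_of_forall_sdiff_eq_zero isClosed_closure.measurableSet
      subset_closure fun x hx => ?_
    rw [h0 x hx.2, abs_zero, Real.zero_rpow hp.ne']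

/-! ### The eigenvalues along the algorithm -/

theorem AFEM.isRegularElement {d : ℕ} {Ω : Set (E d)} {p γ : ℝ} (A : AFEM d Ω p γ) (k : ℕ)
    {K : Set (E d)} (hK : K ∈ A.T k) : IsRegularElement d γ K :=
  ⟨((A.tri k).1 K hK).convex, ((A.tri k).1 K hK).isCompact, A.shape k K hK⟩

theorem AFEM.μ_eq_gradPow {d : ℕ} {Ω : Set (E d)} {p γ : ℝ} (A : AFEM d Ω p γ) (k : ℕ) :
    A.μ k = gradPow d Ω p (A.u k) := by
  rw [A.eig, rayleigh, A.normed, div_one]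

theorem AFEM.μ_nonneg {d : ℕ} {Ω : Set (E d)} {p γ : ℝ} (A : AFEM d Ω p γ) (k : ℕ) :
    0 ≤ A.μ k := by
  rw [A.μ_eq_gradPow, gradPow]
  exact integral_nonneg fun x => by positivity

theorem AFEM.μ_le_μ_zero {d : ℕ} {Ω : Set (E d)} {p γ : ℝ} (hp : 1 < p) (A : AFEM d Ω p γ)
    (k : ℕ) : A.μ k ≤ A.μ 0 := by
  have hmono : Monotone fun k => femSpace d Ω (A.T k) := monotone_nat_of_le_succ A.nested
  have hne : A.u 0 ≠ 0 := by
    intro h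
    have h1 := A.normed 0
    simp [h, lpPow, Real.zero_rpow (show p ≠ 0 by linarith)] at h1
  rw [A.eig k, A.eig 0]
  exact A.minim k _ (hmono (Nat.zero_le k) (A.mem 0)) hne

theorem AFEM.meshSize_le {d : ℕ} {Ω : Set (E d)} (hΩb : Bornology.IsBounded Ω) {p γ : ℝ}
    (A : AFEM d Ω p γ) (k : ℕ) {K : Set (E d)} (hK : K ∈ A.T k) :
    meshSize d K ≤ meshSize d (closure Ω) := by
  have hsub : K ⊆ closure Ω := (A.tri k).2.1 ▸ Set.subset_biUnion_of_mem (u := id) hK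
  exact Real.rpow_le_rpow ENNReal.toReal_nonneg
    (measureReal_mono (μ := volume) hsub hΩb.closure.measure_lt_top.ne) (by positivity)

/-- Stability of the local error indicator along the adaptive
algorithm: η_k^q(μ_k,u_k;K) ≤ C (h_K^q ‖u_k‖_{L^p(K)}^p + ‖∇u_k‖_{L^p(D_K)}^p) for all
K ∈ T_k, and the global estimator is uniformly bounded: η_k(μ_k,u_k) ≤ C̃, with C, C̃
depending on μ_0 and the shape regularity but not on k. -/
theorem estimator_stability
    (d : ℕ) (hd : d = 2 ∨ d = 3) (Ω : Set (E d)) (hΩo : IsOpen Ω)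
    (hΩb : Bornology.IsBounded Ω) (hΩc : IsConnected Ω)
    (p : ℝ) (hp : 1 < p) (γ : ℝ) (hγ : 0 < γ)
    (A : AFEM d Ω p γ) :
    ∃ C > 0, ∃ C' > 0, ∀ k : ℕ,
      (∀ K ∈ A.T k,
        etaQLoc d Ω p (A.T k) (A.g k) (A.μ k) (A.u k) K ≤
          C * (meshSize d K ^ (p / (p - 1)) * (∫ x in K, |A.u k x| ^ p)
            + ∫ x in patch d (A.T k) K, ‖gradient (A.u k) x‖ ^ p)) ∧
      etaOn d Ω p (A.T k) (A.g k) (A.μ k) (A.u k) (A.T k) ≤ C' := by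
  obtain ⟨n, hn, rfl⟩ : ∃ n : ℕ, n ≠ 0 ∧ d = n + 1 := by
    rcases hd with rfl | rfl
    exacts [⟨1, by norm_num, rfl⟩, ⟨2, by norm_num, rfl⟩]
  set q := p / (p - 1) with hq
  have hq0 : 0 ≤ q := div_nonneg (by linarith) (by linarith)
  set c₀ : ℝ := γ ^ (n + 1) / volume.real (ball (0 : E (n + 1)) 1) with hc₀
  set c₁ : ℝ := (2 * γ + 1) ^ (n + 1) * c₀ with hc₁
  set c₂ : ℝ := (2 * n) ^ (n + 1) * 2 ^ q with hc₂
  have hc₀0 : 0 ≤ c₀ := div_nonneg (by positivity) measureReal_nonneg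
  have hc₁0 : 0 ≤ c₁ := by positivity
  have hc₂0 : 0 ≤ c₂ := by positivity
  have hμ0 := A.μ_nonneg 0
  set H := meshSize (n + 1) (closure Ω) with hH
  have hH0 : 0 ≤ H := by rw [hH, meshSize]; positivity
  refine ⟨A.μ 0 ^ q + c₂ * (c₁ + c₀) + 1, by positivity,
    (A.μ 0 ^ q * H ^ q + c₂ * (2 * c₁ * A.μ 0)) ^ ((p - 1) / p) + 1, by positivity,
    fun k => ?_⟩
  have hreg : ∀ K ∈ A.T k, IsRegularElement (n + 1) γ K := fun K hK => A.isRegularElement k hK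
  obtain ⟨-, hcover, hdisj⟩ := A.tri k
  have hμq : A.μ k ^ q ≤ A.μ 0 ^ q :=
    Real.rpow_le_rpow (A.μ_nonneg k) (A.μ_le_μ_zero hp k) hq0
  have hloc := fun K (hK : K ∈ A.T k) => etaQLoc_le n hn Ω hp (fun K hK => (hreg K hK).2.1)
    (A.g k) (A.μ_nonneg k) (A.u k) hK
  have hI0 : ∀ K : Set (E (n + 1)), 0 ≤ ∫ x in K, |A.u k x| ^ p := fun K =>
    integral_nonneg fun x => by positivity
  have hmesh0 : ∀ K : Set (E (n + 1)), 0 ≤ meshSize (n + 1) K := fun K => by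
    rw [meshSize]; positivity
  constructor
  · intro K hK
    have hD0 : 0 ≤ ∫ x in patch (n + 1) (A.T k) K, ‖gradient (A.u k) x‖ ^ p :=
      integral_nonneg fun x => by positivity
    have hpatch := sum_touchWeight_mul_le_patch (p := p) n.succ_pos hγ hreg hdisj
      (A.gradComp k) hK
    have hV0 : 0 ≤ meshSize (n + 1) K ^ q * ∫ x in K, |A.u k x| ^ p :=
      mul_nonneg (Real.rpow_nonneg (hmesh0 K) _) (hI0 K)
    calc _ ≤ A.μ k ^ q * (meshSize (n + 1) K ^ q * ∫ x in K, |A.u k x| ^ p)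
          + c₂ * ∑ K' ∈ A.T k, touchWeight (n + 1) K K' * (‖A.g k K‖ ^ p + ‖A.g k K'‖ ^ p) :=
          hloc K hK
      _ ≤ A.μ 0 ^ q * (meshSize (n + 1) K ^ q * ∫ x in K, |A.u k x| ^ p)
          + c₂ * ((c₁ + c₀) * ∫ x in patch (n + 1) (A.T k) K, ‖gradient (A.u k) x‖ ^ p) := by
          gcongr
      _ = A.μ 0 ^ q * (meshSize (n + 1) K ^ q * ∫ x in K, |A.u k x| ^ p)
          + (c₂ * (c₁ + c₀)) * ∫ x in patch (n + 1) (A.T k) K, ‖gradient (A.u k) x‖ ^ p := by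
          ring
      _ ≤ _ := by
          rw [mul_add (A.μ 0 ^ q + c₂ * (c₁ + c₀) + 1)]
          gcongr
          · have : 0 ≤ c₂ * (c₁ + c₀) := by positivity
            linarith
          · have : 0 ≤ A.μ 0 ^ q := by positivity
            linarith
  · have hvanish := (A.mem k).2.1
    have hlp := sum_setIntegral_le_lpPow (by linarith : 0 < p) hreg hcover hdisj hvanish
      (A.gradComp k)
    rw [A.normed k] at hlp
    have hen := sum_energy_le_gradPow hΩo hp hreg hcover hdisj hvanish (A.gradComp k)
    rw [← A.μ_eq_gradPow k] at hen
    have hsum : ∑ K ∈ A.T k, etaQLoc (n + 1) Ω p (A.T k) (A.g k) (A.μ k) (A.u k) K ≤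
        A.μ 0 ^ q * H ^ q + c₂ * (2 * c₁ * A.μ 0) := by
      calc _ ≤ ∑ K ∈ A.T k, (A.μ 0 ^ q * H ^ q * (∫ x in K, |A.u k x| ^ p)
            + c₂ * ∑ K' ∈ A.T k,
              touchWeight (n + 1) K K' * (‖A.g k K‖ ^ p + ‖A.g k K'‖ ^ p)) := by
            refine Finset.sum_le_sum fun K hK => (hloc K hK).trans (add_le_add_left ?_ _)
            rw [← mul_assoc]
            refine mul_le_mul_of_nonneg_right ?_ (hI0 K)
            exact mul_le_mul hμq (Real.rpow_le_rpow (hmesh0 K) (A.meshSize_le hΩb k hK) hq0)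
              (Real.rpow_nonneg (hmesh0 K) _) (by positivity)
        _ ≤ A.μ 0 ^ q * H ^ q * 1 + c₂ * (2 * c₁ * A.μ 0) := by
            rw [Finset.sum_add_distrib, ← Finset.mul_sum, ← Finset.mul_sum]
            gcongr
            refine (sum_sum_touchWeight_mul_le n.succ_pos hγ hreg hdisj (A.g k)).trans ?_
            exact mul_le_mul_of_nonneg_left (hen.trans (A.μ_le_μ_zero hp k)) (by positivity)
        _ = _ := by ring
    have hexp : 0 ≤ (p - 1) / p := div_nonneg (by linarith) (by linarith)
    have := Real.rpow_le_rpow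
      (Finset.sum_nonneg fun K _ => etaQLoc_nonneg (n + 1) Ω p (A.T k) (A.g k) (A.μ k) (A.u k) K)
      hsum hexp
    rw [etaOn]
    linarith

end PLaplacianAFEM
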